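/- Let b ∈ ℝ with −1 < b ≤ 1 and b ≠ −1/2, and let 𝔤 = 𝒜₄,₉^b be the 4-dimensional real Lie algebra with brackets [e₂,e₃] = e₁, [e₁,e₄] = (b+1)e₁, [e₂,e₄] = e₂, [e₃,e₄] = b e₃. Then for every inner product g on 𝔤 and every alternating 2-form F on 𝔤 such that (g,F) is a solution of the Einstein–Maxwell equations, the metric g is Einstein. -/

import Mathlib

open scoped BigOperators

noncomputable section

/-- The underlying vector space `ℝ⁴` of the 4-dimensional Lie algebra. -/
abbrev V4 : Type := Fin 4 → ℝ

/-- The standard basis `e₁, e₂, e₃, e₄` (0-indexed). -/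
def ee (i : Fin 4) : V4 := Pi.single i 1

/-- `g` is an inner product: a positive-definite symmetric bilinear form. -/
structure IsInnerProduct (g : V4 → V4 → ℝ) : Prop where
  symm : ∀ x y, g x y = g y x
  add_left : ∀ x y z, g (x + y) z = g x z + g y z
  smul_left : ∀ (a : ℝ) (x y : V4), g (a • x) y = a * g x y
  pos : ∀ x : V4, x ≠ 0 → 0 < g x x

/-- `F` is an alternating bilinear 2-form. -/
structure IsAltForm (F : V4 → V4 → ℝ) : Prop where
  skew : ∀ x y, F x y = - F y x
  add_left : ∀ x y z, F (x + y) z = F x z + F y z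
  smul_left : ∀ (a : ℝ) (x y : V4), F (a • x) y = a * F x y

/-- Chevalley–Eilenberg differential of a 2-form with respect to the bracket `br`:
`dF(x,y,z) = −F([x,y],z) + F([x,z],y) − F([y,z],x)`. -/
def cdiff (br : V4 → V4 → V4) (F : V4 → V4 → ℝ) (x y z : V4) : ℝ :=
  - F (br x y) z + F (br x z) y - F (br y z) x

/-- A 2-form is closed if its Chevalley–Eilenberg differential vanishes. -/
def IsClosedForm (br : V4 → V4 → V4) (F : V4 → V4 → ℝ) : Prop :=
  ∀ x y z, cdiff br F x y z = 0

/-- The Gram matrix of a bilinear form in the standard basis. -/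
def gram (g : V4 → V4 → ℝ) : Matrix (Fin 4) (Fin 4) ℝ :=
  Matrix.of fun i j => g (ee i) (ee j)

/-- The inverse Gram matrix. -/
def ginv (g : V4 → V4 → ℝ) : Matrix (Fin 4) (Fin 4) ℝ := (gram g)⁻¹

/-- The inner product induced by `g` on 2-forms:
`⟨α,β⟩ = (1/2) Σ g^{ik} g^{jl} α_{ij} β_{kl}`. -/
def formInner (g : V4 → V4 → ℝ) (α β : V4 → V4 → ℝ) : ℝ :=
  (1 / 2) * ∑ i, ∑ j, ∑ k, ∑ l,
    ginv g i k * ginv g j l * α (ee i) (ee j) * β (ee k) (ee l)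

/-- The volume form of `g` for the orientation `e¹∧e²∧e³∧e⁴`. -/
def vol (g : V4 → V4 → ℝ) (x y z w : V4) : ℝ :=
  Real.sqrt (gram g).det * Matrix.det (Matrix.of fun i j => ![x, y, z, w] i j)

/-- The wedge product of two 2-forms, as a 4-form. -/
def wedge22 (α β : V4 → V4 → ℝ) (x y z w : V4) : ℝ :=
  α x y * β z w - α x z * β y w + α x w * β y z
    + α z w * β x y - α y w * β x z + α y z * β x w

/-- `sF` is the Hodge star `⋆F` of `F` with respect to `g` and the orientation
`e¹∧e²∧e³∧e⁴`: it is the 2-form with `α ∧ sF = ⟨α,F⟩_g vol_g` for all 2-forms `α`. -/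
def IsHodgeStar (g : V4 → V4 → ℝ) (F sF : V4 → V4 → ℝ) : Prop :=
  IsAltForm sF ∧
    ∀ α : V4 → V4 → ℝ, IsAltForm α → ∀ x y z w,
      wedge22 α sF x y z w = formInner g α F * vol g x y z w

/-- `F` is co-closed: `d(⋆F) = 0`. -/
def IsCoclosed (br : V4 → V4 → V4) (g F : V4 → V4 → ℝ) : Prop :=
  ∃ sF, IsHodgeStar g F sF ∧ IsClosedForm br sF

/-- Koszul expression: `g(∇ₓy, z) = (1/2)(g([x,y],z) − g([y,z],x) + g([z,x],y))`. -/
def koszul (br : V4 → V4 → V4) (g : V4 → V4 → ℝ) (x y z : V4) : ℝ :=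
  (1 / 2) * (g (br x y) z - g (br y z) x + g (br z x) y)

/-- The Levi-Civita product `∇ₓ y`, i.e. the unique vector with
`g(∇ₓy, z) = koszul x y z` for all `z` (computed via the inverse Gram matrix). -/
def LC (br : V4 → V4 → V4) (g : V4 → V4 → ℝ) (x y : V4) : V4 :=
  fun m => ∑ k, koszul br g x y (ee k) * ginv g k m

/-- Curvature `R(x,y)z = ∇ₓ∇_y z − ∇_y∇ₓ z − ∇_{[x,y]} z`. -/
def curv (br : V4 → V4 → V4) (g : V4 → V4 → ℝ) (x y z : V4) : V4 :=
  LC br g x (LC br g y z) - LC br g y (LC br g x z) - LC br g (br x y) z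

/-- Ricci tensor `Ric(x,y) = Σᵢ g(R(vᵢ,x)y, vᵢ)` for a `g`-orthonormal basis `(vᵢ)`,
i.e. the trace of the endomorphism `z ↦ R(z,x)y`. -/
def ricci (br : V4 → V4 → V4) (g : V4 → V4 → ℝ) (x y : V4) : ℝ :=
  ∑ i, curv br g (ee i) x y i

/-- Scalar curvature: the `g`-trace of the Ricci tensor. -/
def scal (br : V4 → V4 → V4) (g : V4 → V4 → ℝ) : ℝ :=
  ∑ a, ∑ b, ginv g a b * ricci br g (ee a) (ee b)

/-- Trace-free Ricci tensor `Ric₀ = Ric − (s/4) g`. -/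
def ricci0 (br : V4 → V4 → V4) (g : V4 → V4 → ℝ) (x y : V4) : ℝ :=
  ricci br g x y - (scal br g / 4) * g x y

/-- `g` is Einstein: `Ric₀ = 0`. -/
def IsEinstein (br : V4 → V4 → V4) (g : V4 → V4 → ℝ) : Prop :=
  ∀ x y, ricci0 br g x y = 0

/-- The endomorphism `F̂` with `g(F̂x, y) = F(x,y)` (computed via the inverse Gram matrix). -/
def fhat (g F : V4 → V4 → ℝ) (x : V4) : V4 :=
  fun m => ∑ k, F x (ee k) * ginv g k m

/-- `[F∘F]₀(x,y) = g(F̂(F̂x), y) − (1/4) tr(F̂∘F̂) g(x,y)`. -/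
def FF0 (g F : V4 → V4 → ℝ) (x y : V4) : ℝ :=
  g (fhat g F (fhat g F x)) y
    - (1 / 4) * (∑ i, fhat g F (fhat g F (ee i)) i) * g x y

/-- `(g, F)` is a solution of the Einstein--Maxwell equations:
`dF = 0`, `d(⋆F) = 0`, and `Ric₀ = −[F∘F]₀`. -/
def IsEMSolution (br : V4 → V4 → V4) (g F : V4 → V4 → ℝ) : Prop :=
  IsClosedForm br F ∧ IsCoclosed br g F ∧ ∀ x y, ricci0 br g x y = - FF0 g F x y

/-- Nijenhuis tensor `N_J(x,y) = [Jx,Jy] − J[Jx,y] − J[x,Jy] − [x,y]`. -/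
def nijenhuis (br : V4 → V4 → V4) (J : V4 →ₗ[ℝ] V4) (x y : V4) : V4 :=
  br (J x) (J y) - J (br (J x) y) - J (br x (J y)) - br x y

/-- The Lie algebra `𝒜₄,₉^b`: `[e₂,e₃] = e₁`, `[e₁,e₄] = (b+1)e₁`, `[e₂,e₄] = e₂`, `[e₃,e₄] = b e₃`. -/
def brA49 (b : ℝ) : V4 → V4 → V4 := fun x y =>
  ((x 1 * y 2 - x 2 * y 1) + (b + 1) * (x 0 * y 3 - x 3 * y 0)) • ee 0
    + (x 1 * y 3 - x 3 * y 1) • ee 1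
    + (b * (x 2 * y 3 - x 3 * y 2)) • ee 2

/-- A map `V4 → V4 → ℝ` is bilinear. -/
structure IsBilin (B : V4 → V4 → ℝ) : Prop where
  add_left : ∀ x y z, B (x + y) z = B x z + B y z
  smul_left : ∀ (a : ℝ) (x y : V4), B (a • x) y = a * B x y
  add_right : ∀ x y z, B x (y + z) = B x y + B x z
  smul_right : ∀ (a : ℝ) (x y : V4), B x (a • y) = a * B x y

theorem IsInnerProduct.isBilin {g : V4 → V4 → ℝ} (hg : IsInnerProduct g) : IsBilin g where
  add_left := hg.add_left
  smul_left := hg.smul_left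
  add_right x y z := by rw [hg.symm, hg.add_left, hg.symm y, hg.symm z]
  smul_right a x y := by rw [hg.symm, hg.smul_left, hg.symm y]

theorem IsAltForm.isBilin {F : V4 → V4 → ℝ} (hF : IsAltForm F) : IsBilin F where
  add_left := hF.add_left
  smul_left := hF.smul_left
  add_right x y z := by rw [hF.skew, hF.add_left, hF.skew y, hF.skew z]; ring
  smul_right a x y := by rw [hF.skew, hF.smul_left, hF.skew y]; ring

theorem IsAltForm.self {F : V4 → V4 → ℝ} (hF : IsAltForm F) (x : V4) : F x x = 0 := by
  linarith [hF.skew x x]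

theorem eq_sum_smul_ee (x : V4) : x = ∑ i, x i • ee i := by
  ext j
  simp [ee, Pi.single_apply]

namespace IsBilin

variable {B : V4 → V4 → ℝ}

theorem sum_left (hB : IsBilin B) (c : Fin 4 → ℝ) (v : Fin 4 → V4) (y : V4) :
    B (∑ i, c i • v i) y = ∑ i, c i * B (v i) y := by
  simp only [Fin.sum_univ_four, hB.add_left, hB.smul_left]

theorem sum_right (hB : IsBilin B) (c : Fin 4 → ℝ) (v : Fin 4 → V4) (x : V4) :
    B x (∑ i, c i • v i) = ∑ i, c i * B x (v i) := by
  simp only [Fin.sum_univ_four, hB.add_right, hB.smul_right]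

theorem eq_sum (hB : IsBilin B) (x y : V4) :
    B x y = ∑ i, ∑ j, x i * (y j * B (ee i) (ee j)) := by
  conv_lhs => rw [eq_sum_smul_ee x, eq_sum_smul_ee y, hB.sum_left]
  simp only [hB.sum_right, Finset.mul_sum]

theorem eq_dotProduct (hB : IsBilin B) (x y : V4) : B x y = x ⬝ᵥ (gram B).mulVec y := by
  rw [hB.eq_sum]
  simp only [dotProduct, Matrix.mulVec, Finset.mul_sum, gram, Matrix.of_apply]
  exact Finset.sum_congr rfl fun i _ => Finset.sum_congr rfl fun j _ => by ring

theorem gram_frame (hB : IsBilin B) (P : Fin 4 → V4) (a b : Fin 4) :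
    (Matrix.of P * gram B * (Matrix.of P).transpose) a b = B (P a) (P b) := by
  rw [hB.eq_dotProduct, Matrix.mul_assoc, Matrix.mul_apply_eq_vecMul, Matrix.vecMul,
    Matrix.mulVec_eq_sum]
  simp [dotProduct, Matrix.mul_apply, mul_comm]

end IsBilin

theorem IsInnerProduct.posDef_gram {g : V4 → V4 → ℝ} (hg : IsInnerProduct g) :
    (gram g).PosDef := by
  refine Matrix.PosDef.of_dotProduct_mulVec_pos ?_ fun x hx => ?_
  · ext i j
    simp [gram, hg.symm (ee i)]
  · rw [star_trivial, ← hg.isBilin.eq_dotProduct]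
    exact hg.pos x hx

/-- The rows of `P` form a `g`-orthonormal basis. -/
def IsFrame (g : V4 → V4 → ℝ) (P : Fin 4 → V4) : Prop :=
  Matrix.of P * gram g * (Matrix.of P).transpose = 1

/-- Gram–Schmidt: every inner product has an orthonormal basis adapted to the standard flag. -/
theorem IsInnerProduct.exists_lower_frame {g : V4 → V4 → ℝ} (hg : IsInnerProduct g) :
    ∃ P : Fin 4 → V4, IsFrame g P ∧ ∀ i j, i < j → P i j = 0 := by
  have hS := hg.posDef_gram
  set L := LDL.lowerInv hS with hL
  set d := LDL.diagEntries hS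
  have hconj : Matrix.diagonal d = L * gram g * L.transpose := LDL.diag_eq_lowerInv_conj hS
  have hinj : Function.Injective L.vecMul :=
    Matrix.vecMul_injective_of_isUnit (isUnit_of_invertible L)
  have hpos : ∀ i, 0 < d i := by
    have h := hS.mul_mul_conjTranspose_same hinj
    rw [Matrix.conjTranspose_eq_transpose_of_trivial, ← hconj] at h
    exact Matrix.posDef_diagonal_iff.mp h
  refine ⟨fun i j => (Matrix.diagonal (fun i => (√(d i))⁻¹) * L) i j, ?_, fun i j hij => ?_⟩
  · change Matrix.diagonal (fun i => (√(d i))⁻¹) * L * gram g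
      * (Matrix.diagonal (fun i => (√(d i))⁻¹) * L).transpose = 1
    rw [Matrix.transpose_mul, Matrix.diagonal_transpose]
    calc _ = Matrix.diagonal (fun i => (√(d i))⁻¹) * (L * gram g * L.transpose)
          * Matrix.diagonal (fun i => (√(d i))⁻¹) := by simp only [Matrix.mul_assoc]
      _ = 1 := by
        rw [← hconj, Matrix.diagonal_mul_diagonal, Matrix.diagonal_mul_diagonal,
          ← Matrix.diagonal_one]
        congr 1
        ext i
        have h := Real.sqrt_pos.mpr (hpos i)
        have h' := Real.mul_self_sqrt (hpos i).le
        field_simp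
        nlinarith
  · simp only [Matrix.diagonal_mul, hL, LDL.lowerInv_triangular hS hij, mul_zero]

namespace IsFrame

variable {g F : V4 → V4 → ℝ} {P : Fin 4 → V4}

theorem apply_apply (hP : IsFrame g P) (hg : IsInnerProduct g) (a b : Fin 4) :
    g (P a) (P b) = if a = b then 1 else 0 := by
  rw [← hg.isBilin.gram_frame, hP, Matrix.one_apply]

theorem ginv_eq (hP : IsFrame g P) : ginv g = (Matrix.of P).transpose * Matrix.of P := by
  refine Matrix.inv_eq_left_inv ?_
  rw [Matrix.mul_assoc]
  exact mul_eq_one_comm.mp hP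

theorem det_mul_det (hP : IsFrame g P) : (Matrix.of P).det * (gram g).det * (Matrix.of P).det = 1 := by
  have h := congrArg Matrix.det hP
  rwa [Matrix.det_mul, Matrix.det_mul, Matrix.det_transpose, Matrix.det_one] at h

theorem det_ne_zero (hP : IsFrame g P) : (Matrix.of P).det ≠ 0 := fun h => by
  simpa [h] using hP.det_mul_det

theorem vol_ne_zero (hP : IsFrame g P) (hg : IsInnerProduct g) :
    vol g (P 0) (P 1) (P 2) (P 3) ≠ 0 := by
  have h : (Matrix.of fun i j => ![P 0, P 1, P 2, P 3] i j) = Matrix.of P := by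
    ext i j
    fin_cases i <;> rfl
  rw [vol, h]
  exact mul_ne_zero (Real.sqrt_pos.mpr hg.posDef_gram.det_pos).ne' hP.det_ne_zero

theorem eq_sum (hP : IsFrame g P) (hg : IsInnerProduct g) (x : V4) :
    x = ∑ a, g x (P a) • P a := by
  have h : Matrix.vecMul x (gram g * (Matrix.of P).transpose * Matrix.of P) = x := by
    rw [mul_eq_one_comm.mp ((Matrix.mul_assoc _ _ _).symm.trans hP), Matrix.vecMul_one]
  rw [← Matrix.vecMul_vecMul] at h
  have hc : Matrix.vecMul x (gram g * (Matrix.of P).transpose) = fun a => g x (P a) := by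
    ext a
    rw [hg.isBilin.eq_dotProduct, ← Matrix.vecMul_vecMul, Matrix.vecMul_transpose,
      Matrix.dotProduct_mulVec, dotProduct_comm]
    rfl
  rw [hc] at h
  conv_lhs => rw [← h]
  ext m
  simp [Matrix.vecMul, dotProduct]

theorem formInner_eq (hP : IsFrame g P) {α : V4 → V4 → ℝ} (hα : IsBilin α) (hF : IsBilin F) :
    formInner g α F = (1 / 2) * ∑ a, ∑ b, α (P a) (P b) * F (P a) (P b) := by
  have h : ∑ i, ∑ j, ∑ k, ∑ l,
      ginv g i k * ginv g j l * α (ee i) (ee j) * F (ee k) (ee l)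
      = ((gram α).transpose * (ginv g * gram F * (ginv g).transpose)).trace := by
    rw [Matrix.trace, Finset.sum_comm]
    simp only [Matrix.diag_apply, Matrix.mul_apply, Matrix.transpose_apply, Finset.mul_sum,
      Finset.sum_mul, gram, Matrix.of_apply]
    refine Finset.sum_congr rfl fun j _ => Finset.sum_congr rfl fun i _ => ?_
    rw [Finset.sum_comm]
    exact Finset.sum_congr rfl fun l _ => Finset.sum_congr rfl fun k _ => by ring
  have h' : ((gram α).transpose * (ginv g * gram F * (ginv g).transpose)).trace
      = ((Matrix.of P * gram α * (Matrix.of P).transpose).transpose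
        * (Matrix.of P * gram F * (Matrix.of P).transpose)).trace := by
    rw [hP.ginv_eq]
    simp only [Matrix.transpose_mul, Matrix.transpose_transpose]
    simp only [Matrix.mul_assoc]
    rw [Matrix.trace_mul_comm (Matrix.of P)]
    simp only [Matrix.mul_assoc]
  rw [formInner, h, h', Matrix.trace, Finset.sum_comm]
  congr 1
  refine Finset.sum_congr rfl fun b _ => ?_
  rw [Matrix.diag_apply, Matrix.mul_apply]
  exact Finset.sum_congr rfl fun a _ => by
    rw [Matrix.transpose_apply, hα.gram_frame, hF.gram_frame]

theorem fhat_eq (hP : IsFrame g P) (hF : IsBilin F) (x : V4) :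
    fhat g F x = ∑ a, F x (P a) • P a := by
  have h : ∀ a, F x (P a) = ∑ k, P a k * F x (ee k) := fun a => by
    conv_lhs => rw [eq_sum_smul_ee (P a), hF.sum_right]
  ext m
  simp only [fhat, hP.ginv_eq, h, Finset.sum_apply, Pi.smul_apply, smul_eq_mul, Matrix.mul_apply,
    Matrix.transpose_apply, Matrix.of_apply, Finset.mul_sum, Finset.sum_mul]
  rw [Finset.sum_comm]
  exact Finset.sum_congr rfl fun a _ => Finset.sum_congr rfl fun k _ => by ring

theorem apply_fhat_fhat (hP : IsFrame g P) (hg : IsInnerProduct g) (hF : IsBilin F) (x y : V4) :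
    g (fhat g F (fhat g F x)) y = ∑ a, ∑ b, F x (P a) * F (P a) (P b) * g (P b) y := by
  rw [hP.fhat_eq hF, hg.isBilin.sum_left]
  simp only [hP.fhat_eq hF x, hF.sum_left, Finset.sum_mul]
  exact Finset.sum_comm

theorem trace_fhat_fhat (hP : IsFrame g P) (hF : IsBilin F) :
    ∑ i, fhat g F (fhat g F (ee i)) i = ∑ a, ∑ b, F (P a) (P b) * F (P b) (P a) := by
  have h : ∀ a b, F (P a) (P b) = ∑ i, P a i * F (ee i) (P b) := fun a b => by
    conv_lhs => rw [eq_sum_smul_ee (P a), hF.sum_left]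
  simp only [hP.fhat_eq hF, hF.sum_left, Finset.sum_apply, Pi.smul_apply, smul_eq_mul]
  rw [Finset.sum_comm]
  refine Finset.sum_congr rfl fun a _ => ?_
  simp only [Finset.sum_mul]
  rw [Finset.sum_comm]
  refine Finset.sum_congr rfl fun b _ => ?_
  rw [h a b, Finset.sum_mul]
  exact Finset.sum_congr rfl fun i _ => by ring

/-- The elementary 2-form dual to `P a ∧ P b`. -/
def dualForm (g : V4 → V4 → ℝ) (P : Fin 4 → V4) (a b : Fin 4) (x y : V4) : ℝ :=
  g x (P a) * g y (P b) - g x (P b) * g y (P a)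

theorem isAltForm_dualForm (hg : IsInnerProduct g) (a b : Fin 4) :
    IsAltForm (dualForm g P a b) where
  skew x y := by simp only [dualForm]; ring
  add_left x y z := by simp only [dualForm, hg.add_left]; ring
  smul_left c x y := by simp only [dualForm, hg.smul_left]; ring

theorem hodgeStar_apply (hP : IsFrame g P) (hg : IsInnerProduct g) (hF : IsAltForm F)
    {sF : V4 → V4 → ℝ} (hs : IsHodgeStar g F sF) (a b : Fin 4) :
    wedge22 (dualForm g P a b) sF (P 0) (P 1) (P 2) (P 3)
      = F (P a) (P b) * vol g (P 0) (P 1) (P 2) (P 3) := by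
  rw [hs.2 _ (isAltForm_dualForm hg a b),
    hP.formInner_eq (isAltForm_dualForm hg a b).isBilin hF.isBilin]
  congr 1
  simp only [dualForm, hP.apply_apply hg, sub_mul, Finset.sum_sub_distrib, ite_mul, mul_ite,
    one_mul, mul_one, zero_mul, mul_zero, Finset.sum_ite_eq', Finset.mem_univ, if_true]
  rw [hF.skew (P b) (P a)]
  ring

/-- A 2-form whose only nonzero components in an orthonormal frame are `F₀₃` and `F₁₂`, with
`F₀₃² = F₁₂²`, is self-dual or anti-self-dual, so its trace-free square vanishes. -/
theorem FF0_eq_zero (hP : IsFrame g P) (hg : IsInnerProduct g) (hF : IsAltForm F)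
    (h01 : F (P 0) (P 1) = 0) (h02 : F (P 0) (P 2) = 0) (h13 : F (P 1) (P 3) = 0)
    (h23 : F (P 2) (P 3) = 0) (h : F (P 1) (P 2) ^ 2 = F (P 0) (P 3) ^ 2) (x y : V4) :
    FF0 g F x y = 0 := by
  have hx : ∀ a, F x (P a) = ∑ b, g x (P b) * F (P b) (P a) := fun a => by
    conv_lhs => rw [hP.eq_sum hg x, hF.isBilin.sum_left]
  have hxy : g x y = ∑ b, g x (P b) * g (P b) y := by
    conv_lhs => rw [hP.eq_sum hg x, hg.isBilin.sum_left]
  rw [FF0, hP.apply_fhat_fhat hg hF.isBilin, hP.trace_fhat_fhat hF.isBilin, hxy]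
  simp only [hx, Fin.sum_univ_four, hF.self, h01, h02, h13, h23, hF.skew (P 1) (P 0),
    hF.skew (P 2) (P 0), hF.skew (P 3) (P 0), hF.skew (P 2) (P 1), hF.skew (P 3) (P 1),
    hF.skew (P 3) (P 2)]
  linear_combination (1 / 2 : ℝ) * (g x (P 0) * g (P 0) y + g x (P 3) * g (P 3) y
    - g x (P 1) * g (P 1) y - g x (P 2) * g (P 2) y) * h

end IsFrame

section A49

variable {b : ℝ} {F : V4 → V4 → ℝ}

theorem IsClosedForm.brA49_apply (h1 : -1 < b) (h3 : b ≠ -(1 / 2)) (hF : IsAltForm F)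
    (h : IsClosedForm (brA49 b) F) :
    F (ee 0) (ee 1) = 0 ∧ F (ee 0) (ee 2) = 0 ∧
      (b + 1) * F (ee 1) (ee 2) = F (ee 0) (ee 3) := by
  have h013 := h (ee 0) (ee 1) (ee 3)
  have h023 := h (ee 0) (ee 2) (ee 3)
  have h123 := h (ee 1) (ee 2) (ee 3)
  simp only [cdiff, brA49, hF.add_left, hF.smul_left] at h013 h023 h123
  have he : ∀ i j : Fin 4, ee i j = if j = i then 1 else 0 := fun i j => by
    simp [ee, Pi.single_apply]
  simp [he] at h013 h023 h123
  rw [hF.skew (ee 1) (ee 0)] at h013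
  rw [hF.skew (ee 2) (ee 0)] at h023
  rw [hF.skew (ee 2) (ee 1)] at h123
  refine ⟨?_, ?_, by linarith⟩
  · refine (mul_eq_zero.mp (?_ : (b + 2) * _ = 0)).resolve_left (by linarith)
    linarith
  · refine (mul_eq_zero.mp (?_ : (2 * b + 1) * _ = 0)).resolve_left fun h => h3 (by linarith)
    linarith

/-- The components of a closed 2-form on `𝒜₄,₉^b` in a basis adapted to the standard flag. -/
theorem IsClosedForm.brA49_lower (h1 : -1 < b) (h3 : b ≠ -(1 / 2)) (hF : IsAltForm F)
    (h : IsClosedForm (brA49 b) F) {P : Fin 4 → V4}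
    (hP : ∀ i j, i < j → P i j = 0) :
    F (P 0) (P 1) = 0 ∧ F (P 0) (P 2) = 0 ∧
      (b + 1) * P 0 0 * P 3 3 * F (P 1) (P 2) = P 1 1 * P 2 2 * F (P 0) (P 3) := by
  obtain ⟨h01, h02, h12⟩ := h.brA49_apply h1 h3 hF
  have p01 := hP 0 1 (by decide)
  have p02 := hP 0 2 (by decide)
  have p03 := hP 0 3 (by decide)
  have p12 := hP 1 2 (by decide)
  have p13 := hP 1 3 (by decide)
  have p23 := hP 2 3 (by decide)
  simp only [hF.isBilin.eq_sum (P _), Fin.sum_univ_four, p01, p02, p03, p12, p13, p23, hF.self,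
    hF.skew (ee 1) (ee 0), hF.skew (ee 2) (ee 0), hF.skew (ee 2) (ee 1), h01, h02, ← h12]
  refine ⟨by ring, by ring, by ring⟩

end A49

/-- `𝒜₄,₉^b` (`−1 < b ≤ 1`, `b ≠ −1/2`) admits no left-invariant non-Einstein solution to the Einstein--Maxwell equations. -/
theorem stmt15 (b : ℝ) (h1 : -1 < b) (h2 : b ≤ 1) (h3 : b ≠ -(1 / 2)) :
    ∀ g F : V4 → V4 → ℝ, IsInnerProduct g → IsAltForm F →
      IsEMSolution (brA49 b) g F → IsEinstein (brA49 b) g := by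
  rintro g F hg hF ⟨hd, ⟨sF, hs, hds⟩, hE⟩ x y
  obtain ⟨P, hP, hL⟩ := hg.exists_lower_frame
  obtain ⟨f01, f02, f12⟩ := hd.brA49_lower h1 h3 hF hL
  obtain ⟨s01, s02, s12⟩ := hds.brA49_lower h1 h3 hs.1 hL
  have hv := hP.vol_ne_zero hg
  have e23 := hP.hodgeStar_apply hg hF hs 2 3
  have e13 := hP.hodgeStar_apply hg hF hs 1 3
  have e03 := hP.hodgeStar_apply hg hF hs 0 3
  have e12 := hP.hodgeStar_apply hg hF hs 1 2
  simp [wedge22, IsFrame.dualForm, hP.apply_apply hg, s01, s02, hv] at e23 e13 e03 e12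
  rw [e03, e12] at s12
  have hdet : (Matrix.of P).det = P 0 0 * P 1 1 * P 2 2 * P 3 3 := by
    rw [Matrix.det_of_isLowerTriangular (Matrix.of P) fun i j hij => hL i j hij, Fin.prod_univ_four]
    rfl
  have hne : (b + 1) * P 0 0 * P 3 3 ≠ 0 := by
    have := hP.det_ne_zero
    rw [hdet] at this
    simp only [mul_ne_zero_iff] at this ⊢
    exact ⟨⟨by linarith, this.1.1.1⟩, this.2⟩
  rw [hE, hP.FF0_eq_zero hg hF f01 f02 e13 e23 ?_, neg_zero]
  refine mul_left_cancel₀ (mul_ne_zero hne hv) ?_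
  linear_combination F (P 1) (P 2) * vol g (P 0) (P 1) (P 2) (P 3) * f12 - F (P 0) (P 3) * s12
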